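/- For every d ∈ ℕ and every finitely supported f : ℤ^d → ℂ one has ‖ sup_{t > 0} |𝓕^{−1}(λ_t^1 · f̂)| ‖_{l^2(ℤ^d)} ≤ 2 · ‖f‖_{l^2(ℤ^d)}, where the supremum is over all real t > 0. -/

import Mathlib

open Finset MeasureTheory
open scoped ENNReal NNReal

noncomputable section

/-- The discrete Fourier transform of a (finitely supported) `f : ℤ^d → ℂ`:
`f̂(ξ) = Σ_x f(x) e(x·ξ)`, where `e(y) = e^{2πiy}`. -/
def ftrans (d : ℕ) (f : (Fin d → ℤ) → ℂ) (ξ : Fin d → ℝ) : ℂ :=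
  ∑ᶠ x : Fin d → ℤ, f x * Complex.exp (2 * (Real.pi : ℂ) * Complex.I * ∑ k, (x k : ℂ) * (ξ k : ℂ))

/-- The inverse Fourier transform `𝓕⁻¹(G)(x) = ∫_{𝕋^d} G(ξ) e(-x·ξ) dξ`,
with `𝕋^d` identified with `[-1/2, 1/2)^d`. -/
def finv (d : ℕ) (G : (Fin d → ℝ) → ℂ) (x : Fin d → ℤ) : ℂ :=
  ∫ ξ in Set.Icc (fun _ => (-(1 / 2) : ℝ)) (fun _ => ((1 / 2) : ℝ)),
    G ξ * Complex.exp (-(2 * (Real.pi : ℂ) * Complex.I * ∑ k, (x k : ℂ) * (ξ k : ℂ)))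

/-- `λ_t¹(ξ) = exp(-(t/d) Σ sin²(π ξ_i))`. -/
def lam1 (d : ℕ) (t : ℝ) (ξ : Fin d → ℝ) : ℝ :=
  Real.exp (-(t / d) * ∑ i, Real.sin (Real.pi * ξ i) ^ 2)

/-- The character `ξ ↦ e(x·ξ)`. -/
def torusChar {d : ℕ} (x : Fin d → ℤ) (ξ : Fin d → ℝ) : ℂ :=
  Complex.exp (2 * (Real.pi : ℂ) * Complex.I * ∑ k, (x k : ℂ) * (ξ k : ℂ))

/-- The unit cube `[-1/2, 1/2]^d`, a fundamental domain of the torus. -/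
def unitBox (d : ℕ) : Set (Fin d → ℝ) :=
  Set.Icc (fun _ => (-(1 / 2) : ℝ)) (fun _ => ((1 / 2) : ℝ))

/-- The convolution kernel of the operator with multiplier `λ_t¹`. -/
def semigroupKernel (d : ℕ) (t : ℝ) (z : Fin d → ℤ) : ℝ :=
  (∫ ξ in unitBox d, (lam1 d t ξ : ℂ) * torusChar z ξ).re

section Characters

variable {d : ℕ}

@[fun_prop]
lemma continuous_torusChar (x : Fin d → ℤ) : Continuous (torusChar x) := by
  unfold torusChar; fun_prop

@[fun_prop]
lemma continuous_lam1 (t : ℝ) : Continuous (lam1 d t) := by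
  unfold lam1; fun_prop

lemma torusChar_add (x y : Fin d → ℤ) (ξ : Fin d → ℝ) :
    torusChar (x + y) ξ = torusChar x ξ * torusChar y ξ := by
  simp only [torusChar, ← Complex.exp_add, ← mul_add, ← Finset.sum_add_distrib]
  congr 2
  refine Finset.sum_congr rfl fun k _ => ?_
  simp only [Pi.add_apply]; push_cast; ring

lemma conj_torusChar (x : Fin d → ℤ) (ξ : Fin d → ℝ) :
    (starRingEnd ℂ) (torusChar x ξ) = torusChar (-x) ξ := by
  simp only [torusChar, ← Complex.exp_conj]
  simp [Complex.conj_ofNat]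

lemma torusChar_sub (x y : Fin d → ℤ) (ξ : Fin d → ℝ) :
    torusChar (x - y) ξ = torusChar x ξ * (starRingEnd ℂ) (torusChar y ξ) := by
  rw [conj_torusChar, ← torusChar_add, sub_eq_add_neg]

lemma norm_torusChar (x : Fin d → ℤ) (ξ : Fin d → ℝ) : ‖torusChar x ξ‖ = 1 := by
  have : (2 * (Real.pi : ℂ) * Complex.I * ∑ k, (x k : ℂ) * (ξ k : ℂ))
      = ((2 * Real.pi * ∑ k, (x k : ℝ) * ξ k : ℝ) : ℂ) * Complex.I := by
    push_cast; ring
  rw [torusChar, this, Complex.norm_exp_ofReal_mul_I]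

lemma integrableOn_unitBox {E : Type*} [NormedAddCommGroup E] {G : (Fin d → ℝ) → E}
    (hG : Continuous G) : IntegrableOn G (unitBox d) :=
  hG.continuousOn.integrableOn_compact isCompact_Icc

lemma integral_exp_int_mul (n : ℤ) :
    ∫ s in Set.Icc (-(1 / 2) : ℝ) (1 / 2), Complex.exp (2 * (Real.pi : ℂ) * Complex.I * (n * s))
      = if n = 0 then 1 else 0 := by
  rw [integral_Icc_eq_integral_Ioc, ← intervalIntegral.integral_of_le (by norm_num)]
  split_ifs with h
  · subst h; simp; norm_num
  · have hc : (2 * (Real.pi : ℂ) * Complex.I * n) ≠ 0 := by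
      simp [Real.pi_ne_zero, h]
    simp_rw [← mul_assoc]
    rw [integral_exp_mul_complex hc, div_eq_zero_iff]
    left
    rw [sub_eq_zero, Complex.exp_eq_exp_iff_exists_int]
    exact ⟨n, by push_cast; ring⟩

lemma volume_restrict_unitBox :
    volume.restrict (unitBox d)
      = Measure.pi fun _ : Fin d => volume.restrict (Set.Icc (-(1 / 2) : ℝ) (1 / 2)) := by
  rw [unitBox, ← Set.pi_univ_Icc, volume_pi, Measure.restrict_pi_pi]

lemma integral_torusChar (x : Fin d → ℤ) :
    ∫ ξ in unitBox d, torusChar x ξ = if x = 0 then 1 else 0 := by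
  have h : ∀ ξ : Fin d → ℝ, torusChar x ξ
      = ∏ k, Complex.exp (2 * (Real.pi : ℂ) * Complex.I * (x k * ξ k)) := fun ξ => by
    rw [torusChar, Finset.mul_sum, Complex.exp_sum]
  simp_rw [h]
  rw [volume_restrict_unitBox, integral_fintype_prod_eq_prod
    (fun k s => Complex.exp (2 * (Real.pi : ℂ) * Complex.I * (x k * (s : ℝ))))]
  simp_rw [integral_exp_int_mul]
  rw [Finset.prod_ite_zero]
  simp [funext_iff]

/-- Bessel's inequality for the characters of the torus. -/
lemma sum_sq_norm_integral_torusChar_le {G : (Fin d → ℝ) → ℂ} (hG : Continuous G)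
    (S : Finset (Fin d → ℤ)) :
    ∑ y ∈ S, ‖∫ ξ in unitBox d, G ξ * (starRingEnd ℂ) (torusChar y ξ)‖ ^ 2
      ≤ ∫ ξ in unitBox d, ‖G ξ‖ ^ 2 := by
  set a : (Fin d → ℤ) → ℂ := fun y => ∫ ξ in unitBox d, G ξ * (starRingEnd ℂ) (torusChar y ξ)
    with ha
  set T : (Fin d → ℝ) → ℂ := fun ξ => ∑ y ∈ S, a y * torusChar y ξ with hT
  have hTc : Continuous T := by fun_prop
  have key : ∀ P : (Fin d → ℝ) → ℂ, Continuous P →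
      ∫ ξ in unitBox d, P ξ * (starRingEnd ℂ) (T ξ)
        = ∑ y ∈ S, (starRingEnd ℂ) (a y) *
          ∫ ξ in unitBox d, P ξ * (starRingEnd ℂ) (torusChar y ξ) := by
    intro P hP
    simp_rw [hT, map_sum, Finset.mul_sum]
    rw [integral_finsetSum _ fun y _ => integrableOn_unitBox (by fun_prop)]
    refine Finset.sum_congr rfl fun y _ => ?_
    rw [← integral_const_mul]
    congr 1; ext ξ; rw [map_mul]; ring
  have h1 : ∫ ξ in unitBox d, G ξ * (starRingEnd ℂ) (T ξ) = ((∑ y ∈ S, ‖a y‖ ^ 2 : ℝ) : ℂ) := by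
    rw [key G hG]; push_cast
    refine Finset.sum_congr rfl fun y _ => ?_
    rw [← Complex.conj_mul']
  have h2 : ∫ ξ in unitBox d, T ξ * (starRingEnd ℂ) (T ξ) = ((∑ y ∈ S, ‖a y‖ ^ 2 : ℝ) : ℂ) := by
    rw [key T hTc]; push_cast
    refine Finset.sum_congr rfl fun y hy => ?_
    rw [← Complex.conj_mul']
    congr 1
    simp_rw [hT, Finset.sum_mul, mul_assoc, ← torusChar_sub]
    rw [integral_finsetSum _ fun y _ => integrableOn_unitBox (by fun_prop)]
    simp_rw [integral_const_mul, integral_torusChar, sub_eq_zero]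
    simp [hy]
  have hre : ∀ P : (Fin d → ℝ) → ℂ, Continuous P →
      ∫ ξ in unitBox d, (P ξ).re = (∫ ξ in unitBox d, P ξ).re := fun P hP =>
    integral_re (integrableOn_unitBox hP)
  have h1' : ∫ ξ in unitBox d, (G ξ * (starRingEnd ℂ) (T ξ)).re = ∑ y ∈ S, ‖a y‖ ^ 2 := by
    rw [hre _ (by fun_prop), h1, Complex.ofReal_re]
  have h2' : ∫ ξ in unitBox d, (T ξ * (starRingEnd ℂ) (T ξ)).re = ∑ y ∈ S, ‖a y‖ ^ 2 := by
    rw [hre _ (by fun_prop), h2, Complex.ofReal_re]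
  have h0 : 0 ≤ ∫ ξ in unitBox d, ‖G ξ - T ξ‖ ^ 2 := integral_nonneg fun _ => by positivity
  have hexp : ∀ ξ, ‖G ξ - T ξ‖ ^ 2 = ‖G ξ‖ ^ 2 - 2 * (G ξ * (starRingEnd ℂ) (T ξ)).re
      + (T ξ * (starRingEnd ℂ) (T ξ)).re := fun ξ => by
    simp only [Complex.sq_norm, Complex.normSq_apply, Complex.sub_re, Complex.sub_im,
      Complex.mul_re, Complex.conj_re, Complex.conj_im]
    ring
  simp_rw [hexp] at h0
  have cre : Continuous fun ξ => (G ξ * (starRingEnd ℂ) (T ξ)).re :=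
    Complex.continuous_re.comp (by fun_prop)
  have cre' : Continuous fun ξ => (T ξ * (starRingEnd ℂ) (T ξ)).re :=
    Complex.continuous_re.comp (by fun_prop)
  rw [integral_add (integrableOn_unitBox (by fun_prop)) (integrableOn_unitBox cre'),
    integral_sub (integrableOn_unitBox (by fun_prop)) (integrableOn_unitBox (by fun_prop)),
    integral_const_mul, h1', h2'] at h0
  linarith

end Characters

section Kernel

variable {d : ℕ}

open scoped ComplexOrder

/-- The Fourier coefficients of powers of `∑ cos (2π ξ_i)` are nonnegative. -/
lemma integral_sum_cos_pow_mul_torusChar_nonneg (k : ℕ) (z : Fin d → ℤ) :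
    0 ≤ ∫ ξ in unitBox d, (((∑ i, Real.cos (2 * Real.pi * ξ i) : ℝ) : ℂ) ^ k) * torusChar z ξ := by
  induction k generalizing z with
  | zero =>
    simp only [pow_zero, one_mul, integral_torusChar]
    split_ifs <;> simp
  | succ k ih =>
    have hsingle : ∀ (i : Fin d) (n : ℤ) (ξ : Fin d → ℝ),
        torusChar (Pi.single i n) ξ = Complex.exp (2 * Real.pi * Complex.I * (n * ξ i)) := by
      intro i n ξ
      rw [torusChar, Finset.sum_eq_single i]
      · simp
      · intro b _ hb; simp [hb]
      · simp
    have hcos : ∀ ξ : Fin d → ℝ, ((∑ i, Real.cos (2 * Real.pi * ξ i) : ℝ) : ℂ)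
        = ∑ i, (1 / 2 : ℂ) *
          (torusChar (Pi.single i 1) ξ + torusChar (Pi.single i (-1)) ξ) := by
      intro ξ
      push_cast
      refine Finset.sum_congr rfl fun i _ => ?_
      rw [hsingle, hsingle, Complex.cos]
      push_cast
      ring_nf
    have hstep : ∀ ξ : Fin d → ℝ,
        (((∑ i, Real.cos (2 * Real.pi * ξ i) : ℝ) : ℂ) ^ (k + 1)) * torusChar z ξ
        = ∑ i, (1 / 2 : ℂ) *
          ((((∑ i, Real.cos (2 * Real.pi * ξ i) : ℝ) : ℂ) ^ k) * torusChar (Pi.single i 1 + z) ξ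
          + (((∑ i, Real.cos (2 * Real.pi * ξ i) : ℝ) : ℂ) ^ k)
            * torusChar (Pi.single i (-1) + z) ξ) := by
      intro ξ
      rw [pow_succ, mul_assoc]
      nth_rewrite 2 [hcos ξ]
      rw [Finset.sum_mul, Finset.mul_sum]
      refine Finset.sum_congr rfl fun i _ => ?_
      rw [torusChar_add, torusChar_add]; ring
    simp_rw [hstep]
    rw [integral_finsetSum _ fun y _ => integrableOn_unitBox (by fun_prop)]
    refine Finset.sum_nonneg fun i _ => ?_
    rw [integral_const_mul, integral_add (integrableOn_unitBox (by fun_prop))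
      (integrableOn_unitBox (by fun_prop))]
    refine mul_nonneg ?_ (add_nonneg (ih _) (ih _))
    rw [show (1 / 2 : ℂ) = ((1 / 2 : ℝ) : ℂ) by push_cast; rfl]
    exact Complex.zero_le_real.2 (by norm_num)

lemma lam1_eq_exp_sum_cos (hd : 1 ≤ d) (t : ℝ) (ξ : Fin d → ℝ) :
    lam1 d t ξ = Real.exp (-(t / 2)) *
      Real.exp (t / (2 * d) * ∑ i, Real.cos (2 * Real.pi * ξ i)) := by
  have hd' : (d : ℝ) ≠ 0 := by positivity
  rw [lam1, ← Real.exp_add]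
  congr 1
  have : ∀ i, Real.sin (Real.pi * ξ i) ^ 2 = 1 / 2 - Real.cos (2 * Real.pi * ξ i) / 2 := fun i => by
    rw [Real.sin_sq_eq_half_sub]; ring_nf
  simp_rw [this, Finset.sum_sub_distrib, ← Finset.sum_div]
  simp
  field_simp
  ring

lemma integral_lam1_mul_torusChar_nonneg (hd : 1 ≤ d) {t : ℝ} (ht : 0 < t) (z : Fin d → ℤ) :
    0 ≤ ∫ ξ in unitBox d, (lam1 d t ξ : ℂ) * torusChar z ξ := by
  set a : ℝ := t / (2 * d) with ha
  have ha0 : 0 ≤ a := by positivity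
  set C : (Fin d → ℝ) → ℝ := fun ξ => ∑ i, Real.cos (2 * Real.pi * ξ i) with hC
  have hCc : Continuous C := by fun_prop
  have hCb : ∀ ξ, |C ξ| ≤ d := fun ξ => by
    refine (Finset.abs_sum_le_sum_abs _ _).trans ?_
    refine (Finset.sum_le_sum fun i _ => Real.abs_cos_le_one _).trans ?_
    simp
  set F : ℕ → (Fin d → ℝ) → ℂ := fun k ξ =>
    ((Real.exp (-(t / 2)) * (a ^ k / k.factorial) : ℝ) : ℂ) * ((C ξ : ℂ) ^ k * torusChar z ξ)
    with hF
  have hFc : ∀ k, Continuous (F k) := fun k => by fun_prop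
  have hFb : ∀ k ξ, ‖F k ξ‖ ≤ Real.exp (-(t / 2)) * ((a * d) ^ k / k.factorial) := by
    intro k ξ
    simp only [hF, norm_mul, norm_torusChar, mul_one, norm_pow, Complex.norm_real, Real.norm_eq_abs]
    rw [abs_of_nonneg (by positivity), mul_pow, mul_assoc, mul_div_right_comm]
    gcongr
    · exact (abs_of_nonneg (by positivity)).le
    · exact hCb ξ
  have hsum : ∀ ξ, HasSum (fun k => F k ξ) ((lam1 d t ξ : ℂ) * torusChar z ξ) := by
    intro ξ
    rw [lam1_eq_exp_sum_cos hd]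
    have h := Complex.hasSum_ofReal.2 (NormedSpace.expSeries_div_hasSum_exp (𝔸 := ℝ) (a * C ξ))
    rw [← Real.exp_eq_exp_ℝ] at h
    have h' := (h.mul_left (Real.exp (-(t / 2)) : ℂ)).mul_right (torusChar z ξ)
    rw [Complex.ofReal_mul]
    have hFeq : (fun k => F k ξ) = fun k : ℕ => (Real.exp (-(t / 2)) : ℂ)
        * (((a * C ξ) ^ k / k.factorial : ℝ) : ℂ) * torusChar z ξ := funext fun k => by
      simp only [hF]
      push_cast
      ring
    rw [hFeq]
    exact h'
  have : IsFiniteMeasure (volume.restrict (unitBox d)) :=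
    ⟨by
      rw [Measure.restrict_apply_univ, unitBox]
      exact isCompact_Icc.measure_lt_top⟩
  have hI := hasSum_integral_of_dominated_convergence (μ := volume.restrict (unitBox d)) (F := F)
    (fun k _ => Real.exp (-(t / 2)) * ((a * d) ^ k / k.factorial))
    (fun k => (hFc k).aestronglyMeasurable) (fun k => Filter.Eventually.of_forall (hFb k))
    (Filter.Eventually.of_forall fun _ => (Real.summable_pow_div_factorial _).mul_left _)
    (integrable_const _) (Filter.Eventually.of_forall hsum)
  refine hI.nonneg fun k => ?_
  rw [hF, integral_const_mul]
  exact mul_nonneg (Complex.zero_le_real.2 (by positivity))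
    (integral_sum_cos_pow_mul_torusChar_nonneg k z)

lemma semigroupKernel_nonneg (hd : 1 ≤ d) {t : ℝ} (ht : 0 < t) (z : Fin d → ℤ) :
    0 ≤ semigroupKernel d t z :=
  (Complex.le_def.1 (integral_lam1_mul_torusChar_nonneg hd ht z)).1

lemma integral_lam1_mul_torusChar (hd : 1 ≤ d) {t : ℝ} (ht : 0 < t) (z : Fin d → ℤ) :
    ∫ ξ in unitBox d, (lam1 d t ξ : ℂ) * torusChar z ξ = (semigroupKernel d t z : ℂ) :=
  Complex.ext rfl (Complex.le_def.1 (integral_lam1_mul_torusChar_nonneg hd ht z)).2.symm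

lemma semigroupKernel_neg (t : ℝ) (z : Fin d → ℤ) :
    semigroupKernel d t (-z) = semigroupKernel d t z := by
  rw [semigroupKernel, semigroupKernel, ← Complex.conj_re, ← integral_conj]
  simp only [map_mul, Complex.conj_ofReal, conj_torusChar, neg_neg]

lemma lam1_max (s t : ℝ) (ξ : Fin d → ℝ) :
    lam1 d (max s t) ξ = min (lam1 d s ξ) (lam1 d t ξ) := by
  have hanti : Antitone fun s => lam1 d s ξ := fun s t hst => by
    refine Real.exp_le_exp.2 (mul_le_mul_of_nonneg_right ?_ (Finset.sum_nonneg fun _ _ => sq_nonneg _))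
    gcongr
  exact hanti.map_max

lemma lam1_nonneg (t : ℝ) (ξ : Fin d → ℝ) : 0 ≤ lam1 d t ξ := (Real.exp_pos _).le

lemma lam1_le_one {t : ℝ} (ht : 0 < t) (ξ : Fin d → ℝ) : lam1 d t ξ ≤ 1 := by
  refine Real.exp_le_one_iff.2 (mul_nonpos_of_nonpos_of_nonneg ?_
    (Finset.sum_nonneg fun _ _ => sq_nonneg _))
  have : 0 ≤ t / d := by positivity
  linarith

end Kernel

/-- The matrix `M min(u_i, u_j) - u_i u_j` is positive semidefinite when `0 ≤ u_i ≤ M`. -/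
lemma sq_sum_mul_le_sum_min {ι : Type*} (F : Finset ι) (u z : ι → ℝ)
    (hu : ∀ i, 0 ≤ u i) (M : ℝ) (hM : ∀ i ∈ F, u i ≤ M) :
    (∑ i ∈ F, u i * z i) ^ 2 ≤ M * ∑ i ∈ F, ∑ j ∈ F, min (u i) (u j) * (z i * z j) := by
  classical
  induction F using Finset.induction_on_max_value u generalizing M with
  | empty => simp
  | insert a s has hmax ih =>
    have h1 := ih (u a) hmax
    have e1 : ∑ i ∈ s, min (u i) (u a) * (z i * z a) = z a * ∑ i ∈ s, u i * z i := by
      rw [Finset.mul_sum]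
      refine Finset.sum_congr rfl fun i hi => ?_
      rw [min_eq_left (hmax i hi)]; ring
    have e2 : ∑ i ∈ s, min (u a) (u i) * (z a * z i) = z a * ∑ i ∈ s, u i * z i := by
      rw [Finset.mul_sum]
      refine Finset.sum_congr rfl fun i hi => ?_
      rw [min_eq_right (hmax i hi)]; ring
    have hua : u a ≤ M := hM a (Finset.mem_insert_self _ _)
    simp only [Finset.sum_insert has, Finset.sum_add_distrib, min_self, e1, e2]
    set L := ∑ i ∈ s, u i * z i
    set Q := ∑ i ∈ s, ∑ j ∈ s, min (u i) (u j) * (z i * z j)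
    have h2 : (u a * z a + L) ^ 2
        ≤ u a * (u a * (z a * z a) + z a * L + (z a * L + Q)) := by nlinarith
    rcases (hu a).eq_or_lt with h0 | h0
    · have hz : ∀ i ∈ s, u i = 0 := fun i hi => le_antisymm (h0 ▸ hmax i hi) (hu i)
      have hL : L = 0 := Finset.sum_eq_zero fun i hi => by rw [hz i hi, zero_mul]
      have hQ : Q = 0 := Finset.sum_eq_zero fun i hi => Finset.sum_eq_zero fun j hj => by
        rw [hz i hi, hz j hj]; simp
      rw [hL, hQ, ← h0]; simp
    · have h3 : 0 ≤ u a * (z a * z a) + z a * L + (z a * L + Q) := by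
        by_contra hneg
        push Not at hneg
        nlinarith [sq_nonneg (u a * z a + L), mul_neg_of_pos_of_neg h0 hneg]
      exact h2.trans (mul_le_mul_of_nonneg_right hua h3)

section Maximal

variable {d : ℕ}

lemma sq_norm_sum_le_sum_min (F : Finset (Fin d → ℤ)) (u c : (Fin d → ℤ) → ℝ)
    (hu : ∀ i, 0 ≤ u i) (hu1 : ∀ i, u i ≤ 1) (ξ : Fin d → ℝ) :
    ‖∑ x ∈ F, (c x : ℂ) * ((u x : ℂ) * torusChar x ξ)‖ ^ 2
      ≤ ∑ x ∈ F, ∑ y ∈ F, c x * c y * (((min (u x) (u y) : ℝ) : ℂ) * torusChar (x - y) ξ).re := by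
  have h1 := sq_sum_mul_le_sum_min F u (fun x => c x * (torusChar x ξ).re) hu 1 fun i _ => hu1 i
  have h2 := sq_sum_mul_le_sum_min F u (fun x => c x * (torusChar x ξ).im) hu 1 fun i _ => hu1 i
  rw [one_mul] at h1 h2
  refine le_trans (le_of_eq ?_) ((add_le_add h1 h2).trans (le_of_eq ?_))
  · rw [Complex.sq_norm, Complex.normSq_apply, Complex.re_sum, Complex.im_sum, ← sq, ← sq]
    congr 2 <;> refine Finset.sum_congr rfl fun x _ => ?_
    · simp only [Complex.re_ofReal_mul]; ring
    · simp only [Complex.im_ofReal_mul]; ring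
  · simp_rw [← Finset.sum_add_distrib]
    refine Finset.sum_congr rfl fun x _ => Finset.sum_congr rfl fun y _ => ?_
    rw [torusChar_sub, Complex.re_ofReal_mul, Complex.mul_re, Complex.conj_re, Complex.conj_im]
    ring

/-- The dual form of the maximal inequality, for a maximal function linearised by `τ`. -/
lemma sum_sq_dual_le (hd : 1 ≤ d) (F S : Finset (Fin d → ℤ)) (τ c : (Fin d → ℤ) → ℝ)
    (hτ : ∀ x, 0 < τ x) (hc : ∀ x, 0 ≤ c x) :
    ∑ y ∈ S, (∑ x ∈ F, c x * semigroupKernel d (τ x) (x - y)) ^ 2 ≤ 4 * ∑ x ∈ F, c x ^ 2 := by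
  set h : (Fin d → ℤ) → ℝ := fun y => ∑ x ∈ F, c x * semigroupKernel d (τ x) (x - y) with hh
  set H : (Fin d → ℝ) → ℂ := fun ξ =>
    ∑ x ∈ F, (c x : ℂ) * ((lam1 d (τ x) ξ : ℂ) * torusChar x ξ) with hH
  have hHc : Continuous H := by fun_prop
  have hcoef : ∀ y, ∫ ξ in unitBox d, H ξ * (starRingEnd ℂ) (torusChar y ξ) = (h y : ℂ) := by
    intro y
    simp_rw [hH, Finset.sum_mul, mul_assoc, ← torusChar_sub]
    rw [integral_finsetSum _ fun y _ => integrableOn_unitBox (by fun_prop)]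
    simp_rw [integral_const_mul, integral_lam1_mul_torusChar hd (hτ _), hh]
    push_cast; rfl
  set I : ℝ := ∫ ξ in unitBox d, ‖H ξ‖ ^ 2 with hI
  have bessel : ∀ S : Finset (Fin d → ℤ), ∑ y ∈ S, h y ^ 2 ≤ I := by
    intro S
    have := sum_sq_norm_integral_torusChar_le hHc S
    simpa only [hcoef, Complex.norm_real, Real.norm_eq_abs, sq_abs] using this
  have hI0 : 0 ≤ I := integral_nonneg fun _ => by positivity
  have hIB : I ≤ ∑ x ∈ F, ∑ y ∈ F, c x * c y * semigroupKernel d (max (τ x) (τ y)) (x - y) := by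
    have hcont : ∀ x y, Continuous fun ξ : Fin d → ℝ =>
        c x * c y * ((lam1 d (max (τ x) (τ y)) ξ : ℂ) * torusChar (x - y) ξ).re := fun x y =>
      continuous_const.mul (Complex.continuous_re.comp (by fun_prop))
    calc I ≤ ∫ ξ in unitBox d, ∑ x ∈ F, ∑ y ∈ F,
          c x * c y * ((lam1 d (max (τ x) (τ y)) ξ : ℂ) * torusChar (x - y) ξ).re := by
          refine integral_mono (integrableOn_unitBox (by fun_prop))
            (integrableOn_unitBox (by fun_prop)) fun ξ => ?_
          simp only [lam1_max]
          exact sq_norm_sum_le_sum_min F (fun x => lam1 d (τ x) ξ) c (fun x => lam1_nonneg _ _)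
            (fun x => lam1_le_one (hτ x) _) ξ
      _ = _ := by
          rw [integral_finsetSum _ fun x _ => integrableOn_unitBox (by fun_prop)]
          refine Finset.sum_congr rfl fun x _ => ?_
          rw [integral_finsetSum _ fun y _ => integrableOn_unitBox (hcont x y)]
          refine Finset.sum_congr rfl fun y _ => ?_
          rw [integral_const_mul, semigroupKernel]
          congr 1
          exact integral_re (𝕜 := ℂ) (μ := volume.restrict (unitBox d))
            (f := fun ξ => (lam1 d (max (τ x) (τ y)) ξ : ℂ) * torusChar (x - y) ξ)
            (integrableOn_unitBox (by fun_prop))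
  have hBh : ∑ x ∈ F, ∑ y ∈ F, c x * c y * semigroupKernel d (max (τ x) (τ y)) (x - y)
      ≤ 2 * ∑ x ∈ F, c x * h x := by
    have e1 : ∑ x ∈ F, c x * h x
        = ∑ x ∈ F, ∑ y ∈ F, c x * c y * semigroupKernel d (τ y) (x - y) := by
      refine Finset.sum_congr rfl fun x _ => ?_
      rw [hh, Finset.mul_sum]
      refine Finset.sum_congr rfl fun y _ => ?_
      rw [← semigroupKernel_neg, neg_sub]; ring
    have e2 : ∑ x ∈ F, c x * h x
        = ∑ x ∈ F, ∑ y ∈ F, c x * c y * semigroupKernel d (τ x) (x - y) := by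
      rw [Finset.sum_comm]
      refine Finset.sum_congr rfl fun x _ => ?_
      rw [hh, Finset.mul_sum]
      refine Finset.sum_congr rfl fun y _ => ?_
      ring
    rw [two_mul]
    nth_rewrite 1 [e2]
    rw [e1, ← Finset.sum_add_distrib]
    refine Finset.sum_le_sum fun x _ => ?_
    rw [← Finset.sum_add_distrib]
    refine Finset.sum_le_sum fun y _ => ?_
    rw [← mul_add]
    refine mul_le_mul_of_nonneg_left ?_ (mul_nonneg (hc x) (hc y))
    rcases max_choice (τ x) (τ y) with h' | h' <;> rw [h']
    · exact le_add_of_nonneg_right (semigroupKernel_nonneg hd (hτ y) _)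
    · exact le_add_of_nonneg_left (semigroupKernel_nonneg hd (hτ x) _)
  have hcs : (∑ x ∈ F, c x * h x) ^ 2 ≤ (∑ x ∈ F, c x ^ 2) * I :=
    (Finset.sum_mul_sq_le_sq_mul_sq F c h).trans
      (mul_le_mul_of_nonneg_left (bessel F) (Finset.sum_nonneg fun _ _ => sq_nonneg _))
  refine (bessel S).trans ?_
  have hI2 : I ^ 2 ≤ 4 * (∑ x ∈ F, c x ^ 2) * I := by
    nlinarith [pow_le_pow_left₀ hI0 (hIB.trans hBh) 2]
  rcases hI0.eq_or_lt with h0 | h0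
  · rw [← h0]; exact mul_nonneg (by norm_num) (Finset.sum_nonneg fun _ _ => sq_nonneg _)
  · exact le_of_mul_le_mul_right (by rw [← sq]; exact hI2) h0

lemma finv_lam1_mul_ftrans (hd : 1 ≤ d) {f : (Fin d → ℤ) → ℂ} (hf : (Function.support f).Finite)
    {t : ℝ} (ht : 0 < t) (x : Fin d → ℤ) :
    finv d (fun ξ => (lam1 d t ξ : ℂ) * ftrans d f ξ) x
      = ∑ y ∈ hf.toFinset, f y * (semigroupKernel d t (x - y) : ℂ) := by
  have hft : ∀ ξ, ftrans d f ξ = ∑ y ∈ hf.toFinset, f y * torusChar y ξ := fun ξ => by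
    refine finsum_eq_sum_of_support_subset _ fun y hy => ?_
    simp only [Set.Finite.coe_toFinset, Function.mem_support] at hy ⊢
    exact left_ne_zero_of_mul hy
  have hint : ∀ ξ, (lam1 d t ξ : ℂ) * ftrans d f ξ *
      Complex.exp (-(2 * (Real.pi : ℂ) * Complex.I * ∑ k, (x k : ℂ) * (ξ k : ℂ)))
      = ∑ y ∈ hf.toFinset, f y * ((lam1 d t ξ : ℂ) * torusChar (y - x) ξ) := fun ξ => by
    have : Complex.exp (-(2 * (Real.pi : ℂ) * Complex.I * ∑ k, (x k : ℂ) * (ξ k : ℂ)))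
        = torusChar (-x) ξ := by simp [torusChar]
    rw [this, hft, Finset.mul_sum, Finset.sum_mul]
    refine Finset.sum_congr rfl fun y _ => ?_
    rw [sub_eq_add_neg, torusChar_add]; ring
  simp only [finv, hint]
  change ∫ ξ in unitBox d, _ = _
  rw [integral_finsetSum _ fun y _ => integrableOn_unitBox (by fun_prop)]
  refine Finset.sum_congr rfl fun y _ => ?_
  rw [integral_const_mul, integral_lam1_mul_torusChar hd ht, ← semigroupKernel_neg, neg_sub]

/-- The maximal inequality for a maximal function linearised by `τ`. -/
lemma sum_sq_norm_finv_le (hd : 1 ≤ d) {f : (Fin d → ℤ) → ℂ} (hf : (Function.support f).Finite)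
    (F : Finset (Fin d → ℤ)) (τ : (Fin d → ℤ) → ℝ) (hτ : ∀ x, 0 < τ x) :
    ∑ x ∈ F, ‖finv d (fun ξ => (lam1 d (τ x) ξ : ℂ) * ftrans d f ξ) x‖ ^ 2
      ≤ 4 * ∑ y ∈ hf.toFinset, ‖f y‖ ^ 2 := by
  set c : (Fin d → ℤ) → ℝ := fun x => ‖finv d (fun ξ => (lam1 d (τ x) ξ : ℂ) * ftrans d f ξ) x‖
    with hcdef
  have hc : ∀ x, 0 ≤ c x := fun x => norm_nonneg _
  have hcle : ∀ x, c x ≤ ∑ y ∈ hf.toFinset, ‖f y‖ * semigroupKernel d (τ x) (x - y) := fun x => by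
    rw [hcdef]
    simp only
    rw [finv_lam1_mul_ftrans hd hf (hτ x)]
    refine (norm_sum_le _ _).trans (le_of_eq (Finset.sum_congr rfl fun y _ => ?_))
    rw [norm_mul, Complex.norm_real, Real.norm_of_nonneg (semigroupKernel_nonneg hd (hτ x) _)]
  have h1 : ∑ x ∈ F, c x ^ 2
      ≤ ∑ y ∈ hf.toFinset, ‖f y‖ * ∑ x ∈ F, c x * semigroupKernel d (τ x) (x - y) := by
    calc ∑ x ∈ F, c x ^ 2
        ≤ ∑ x ∈ F, c x * ∑ y ∈ hf.toFinset, ‖f y‖ * semigroupKernel d (τ x) (x - y) :=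
          Finset.sum_le_sum fun x _ => by
            rw [sq]; exact mul_le_mul_of_nonneg_left (hcle x) (hc x)
      _ = _ := by
          simp_rw [Finset.mul_sum]
          rw [Finset.sum_comm]
          refine Finset.sum_congr rfl fun y _ => Finset.sum_congr rfl fun x _ => ?_
          ring
  have h2 := Finset.sum_mul_sq_le_sq_mul_sq hf.toFinset (fun y => ‖f y‖)
    fun y => ∑ x ∈ F, c x * semigroupKernel d (τ x) (x - y)
  have h3 := sum_sq_dual_le hd F hf.toFinset τ c hτ hc
  have hA : 0 ≤ ∑ x ∈ F, c x ^ 2 := Finset.sum_nonneg fun _ _ => sq_nonneg _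
  have hB : 0 ≤ ∑ y ∈ hf.toFinset, ‖f y‖ ^ 2 := Finset.sum_nonneg fun _ _ => sq_nonneg _
  have h4 := (pow_le_pow_left₀ hA h1 2).trans (h2.trans (mul_le_mul_of_nonneg_left h3 hB))
  rcases hA.eq_or_lt with h0 | h0
  · rw [← h0]; positivity
  · refine le_of_mul_le_mul_right ?_ h0
    linarith

/-- A finite sum of suprema is bounded by `b` as soon as all the sums obtained by choosing an
index in each supremum are. -/
lemma sum_iSup_le_of_forall_choice {α ι : Type*} [Nonempty ι] (F : Finset α) (a : α → ι → ℝ≥0∞)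
    (b : ℝ≥0∞) (h : ∀ τ : α → ι, ∑ x ∈ F, a x (τ x) ≤ b) : ∑ x ∈ F, ⨆ i, a x i ≤ b := by
  classical
  suffices H : ∀ B : ℝ≥0∞, (∀ τ : α → ι, B + ∑ x ∈ F, a x (τ x) ≤ b) →
      B + ∑ x ∈ F, ⨆ i, a x i ≤ b by
    simpa using H 0 (by simpa using h)
  clear h
  induction F using Finset.induction_on with
  | empty => intro B hB; simpa using hB (fun _ => Classical.arbitrary ι)
  | insert x s hx ih =>
    intro B hB
    rw [Finset.sum_insert hx, ← add_assoc, ENNReal.add_iSup, ENNReal.iSup_add]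
    refine iSup_le fun i => ih _ fun τ => ?_
    have hs : ∑ y ∈ s, a y (Function.update τ x i y) = ∑ y ∈ s, a y (τ y) :=
      Finset.sum_congr rfl fun y hy => by
        rw [Function.update_of_ne (ne_of_mem_of_not_mem hy hx)]
    have := hB (Function.update τ x i)
    rwa [Finset.sum_insert hx, Function.update_self, hs, ← add_assoc] at this

end Maximal

/-- Theorem 4.2: for finitely supported `f : ℤ^d → ℂ`,
`‖ sup_{t>0} |𝓕⁻¹(λ_t¹ f̂)| ‖_{l²(ℤ^d)} ≤ 2 ‖f‖_{l²(ℤ^d)}`. -/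
theorem maximal_semigroup_lam1_l2_bound (d : ℕ) (hd : 1 ≤ d)
    (f : (Fin d → ℤ) → ℂ) (hf : (Function.support f).Finite) :
    (∑' x : Fin d → ℤ,
        (⨆ (t : ℝ) (_ : 0 < t),
          (‖finv d (fun ξ => (lam1 d t ξ : ℂ) * ftrans d f ξ) x‖₊ : ℝ≥0∞)) ^ (2 : ℝ)) ^ ((1 : ℝ) / 2)
      ≤ 2 * (∑' x : Fin d → ℤ, (‖f x‖₊ : ℝ≥0∞) ^ (2 : ℝ)) ^ ((1 : ℝ) / 2) := by
  have hnn : ∀ z : ℂ, (‖z‖₊ : ℝ≥0∞) ^ (2 : ℝ) = ENNReal.ofReal (‖z‖ ^ 2) := fun z => by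
    rw [ENNReal.ofReal_pow (norm_nonneg _), ofReal_norm, ENNReal.rpow_two]; rfl
  have main : (∑' x : Fin d → ℤ,
        (⨆ (t : ℝ) (_ : 0 < t),
          (‖finv d (fun ξ => (lam1 d t ξ : ℂ) * ftrans d f ξ) x‖₊ : ℝ≥0∞)) ^ (2 : ℝ))
      ≤ 4 * ∑' x : Fin d → ℤ, (‖f x‖₊ : ℝ≥0∞) ^ (2 : ℝ) := by
    rw [ENNReal.tsum_eq_iSup_sum]
    refine iSup_le fun F => ?_
    have : Nonempty {t : ℝ // 0 < t} := ⟨⟨1, one_pos⟩⟩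
    simp_rw [iSup_subtype']
    have hpow : ∀ g : {t : ℝ // 0 < t} → ℝ≥0∞, (⨆ i, g i) ^ (2 : ℝ) = ⨆ i, g i ^ (2 : ℝ) :=
      fun g => (ENNReal.orderIsoRpow 2 two_pos).map_iSup g
    simp_rw [hpow]
    refine sum_iSup_le_of_forall_choice F _ _ fun τ => ?_
    have hsupp : ∑ y ∈ hf.toFinset, (‖f y‖₊ : ℝ≥0∞) ^ (2 : ℝ)
        ≤ ∑' x : Fin d → ℤ, (‖f x‖₊ : ℝ≥0∞) ^ (2 : ℝ) := ENNReal.sum_le_tsum _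
    refine le_trans ?_ (mul_le_mul_right hsupp 4)
    simp_rw [hnn]
    rw [← ENNReal.ofReal_sum_of_nonneg fun _ _ => by positivity,
      ← ENNReal.ofReal_sum_of_nonneg fun _ _ => by positivity,
      show (4 : ℝ≥0∞) = ENNReal.ofReal 4 by norm_num, ← ENNReal.ofReal_mul (by norm_num)]
    exact ENNReal.ofReal_le_ofReal
      (sum_sq_norm_finv_le hd hf F (fun x => (τ x : ℝ)) fun x => (τ x).2)
  calc _ ≤ (4 * ∑' x : Fin d → ℤ, (‖f x‖₊ : ℝ≥0∞) ^ (2 : ℝ)) ^ ((1 : ℝ) / 2) := by gcongr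
    _ = _ := by
      rw [ENNReal.mul_rpow_of_nonneg _ _ (by norm_num)]
      congr 1
      rw [show (4 : ℝ≥0∞) = 2 ^ (2 : ℝ) by norm_num, ← ENNReal.rpow_mul]
      norm_num
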